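/- Ada-LISTA with varying models (Theorem 2). Suppose y = D x* + e for some x* ∈ ℝ^m and e ∈ ℝ^n. Assume: (1) max_i |G_ii − 1| ≤ ε_d for some ε_d ≥ 0; (2) max_{i≠j} |G_ij| ≤ μ̄ for some μ̄ ≥ 0; (3) s = ‖x*‖₀ satisfies 2 μ̄ s < 1. Let γ ∈ ℝ satisfy 1 < γ and 2 γ ε_d + 2 γ μ̄ s < 1, let θ_max ≥ ‖Aᵀ y‖∞, and run the Ada-LISTA iteration with thresholds θ_k = θ_max γ^{−k}. Then for every K ≥ 0 such that ‖Aᵀ e‖∞ ≤ θ_max γ^{−K} (1 − 2 γ ε_d − 2 γ μ̄ s), the K-th iterate satisfies Supp(x_K) ⊆ Supp(x*) and ‖x_K − x*‖∞ ≤ 2 θ_max γ^{−K}. -/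

import Mathlib

open Matrix

/-- Entrywise soft-thresholding operator with threshold `θ`. -/
noncomputable def softThresh {m : ℕ} (θ : ℝ) (v : Fin m → ℝ) : Fin m → ℝ :=
  fun i => Real.sign (v i) * max (|v i| - θ) 0

/-- The Ada-LISTA iteration (single weight matrix): `x₀ = 0`,
`x_{k+1} = S_{θ_{k+1}}(x_k + Dᵀ Wᵀ (y − D x_k))`. -/
noncomputable def adaIter {n m : ℕ} (D : Matrix (Fin n) (Fin m) ℝ)
    (W : Matrix (Fin n) (Fin n) ℝ) (y : Fin n → ℝ) (θ : ℕ → ℝ) : ℕ → Fin m → ℝ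
  | 0 => 0
  | k + 1 =>
      softThresh (θ (k + 1))
        (adaIter D W y θ k +
          (Dᵀ * Wᵀ).mulVec (y - D.mulVec (adaIter D W y θ k)))

theorem softThresh_apply_eq_zero {m : ℕ} {θ : ℝ} {v : Fin m → ℝ} {i : Fin m} (h : |v i| ≤ θ) :
    softThresh θ v i = 0 := by
  simp [softThresh, max_eq_right (sub_nonpos.mpr h)]

theorem abs_softThresh_sub_le {m : ℕ} {θ : ℝ} (hθ : 0 ≤ θ) (v : Fin m → ℝ) (i : Fin m) :
    |softThresh θ v i - v i| ≤ θ := by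
  rcases le_total |v i| θ with h | h
  · rwa [softThresh_apply_eq_zero h, zero_sub, abs_neg]
  · rw [softThresh, max_eq_left (sub_nonneg.mpr h)]
    rcases lt_trichotomy (v i) 0 with hv | hv | hv
    · rw [Real.sign_of_neg hv, abs_of_neg hv, abs_le]
      constructor <;> linarith
    · simp [hv, hθ]
    · rw [Real.sign_of_pos hv, abs_of_pos hv, abs_le]
      constructor <;> linarith

/-- If `G` is entrywise close to the identity, then `G z` is close to `z` for sparse `z`. -/
theorem abs_mulVec_sub_le {ι : Type*} [Fintype ι] {G : Matrix ι ι ℝ} {ε μ M : ℝ} (hμ0 : 0 ≤ μ)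
    (hdiag : ∀ i, |G i i - 1| ≤ ε) (hoff : ∀ i j, i ≠ j → |G i j| ≤ μ)
    {S : Finset ι} {z : ι → ℝ} (hz : ∀ i, i ∉ S → z i = 0) (hM : ∀ i, |z i| ≤ M) (i : ι) :
    |G.mulVec z i - z i| ≤ (ε + μ * S.card) * M := by
  classical
  have hM0 : 0 ≤ M := (abs_nonneg _).trans (hM i)
  have hε : 0 ≤ ε := (abs_nonneg _).trans (hdiag i)
  have hentry (j : ι) : |(G - 1) i j| ≤ (if i = j then ε else 0) + μ := by
    by_cases hij : i = j
    · subst hij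
      simpa using (hdiag i).trans (le_add_of_nonneg_right hμ0)
    · simpa [Matrix.one_apply_ne hij, hij] using hoff i j hij
  have hsum : G.mulVec z i - z i = ∑ j ∈ S, (G - 1) i j * z j := by
    have h : G.mulVec z i - z i = (G - 1).mulVec z i := by
      simp [Matrix.sub_mulVec]
    rw [h, Matrix.mulVec, dotProduct]
    refine (Finset.sum_subset (Finset.subset_univ S) fun j _ hj => ?_).symm
    rw [hz j hj, mul_zero]
  calc |G.mulVec z i - z i| ≤ ∑ j ∈ S, |(G - 1) i j * z j| := by
        rw [hsum]
        exact Finset.abs_sum_le_sum_abs _ _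
    _ ≤ ∑ j ∈ S, ((if i = j then ε else 0) + μ) * M := by
        refine Finset.sum_le_sum fun j _ => ?_
        rw [abs_mul]
        exact mul_le_mul (hentry j) (hM j) (abs_nonneg _) ((abs_nonneg _).trans (hentry j))
    _ = ((if i ∈ S then ε else 0) + μ * S.card) * M := by
        rw [← Finset.sum_mul, Finset.sum_add_distrib, Finset.sum_ite_eq, Finset.sum_const,
          nsmul_eq_mul, mul_comm μ]
    _ ≤ (ε + μ * S.card) * M := by
        gcongr
        split_ifs
        exacts [le_rfl, hε]

/-- Theorem 2 (Ada-LISTA with varying models), with effective Gram matrix `G = Dᵀ Wᵀ D`. -/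
theorem adaLISTA_varying_models {n m : ℕ}
    (D : Matrix (Fin n) (Fin m) ℝ) (W : Matrix (Fin n) (Fin n) ℝ)
    (xstar : Fin m → ℝ) (e : Fin n → ℝ) (y : Fin n → ℝ)
    (hy : y = D.mulVec xstar + e)
    (εd : ℝ) (hεd : 0 ≤ εd)
    (hdiag : ∀ i, |(Dᵀ * Wᵀ * D) i i - 1| ≤ εd)
    (μ : ℝ) (hμ0 : 0 ≤ μ)
    (hμ : ∀ i j, i ≠ j → |(Dᵀ * Wᵀ * D) i j| ≤ μ)
    (s : ℕ) (hs : s = (Finset.univ.filter fun i => xstar i ≠ 0).card)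
    (hμs : 2 * μ * (s : ℝ) < 1)
    (γ : ℝ) (hγ : 1 < γ) (hγμs : 2 * γ * εd + 2 * γ * μ * (s : ℝ) < 1)
    (θmax : ℝ) (hθmax : ‖(W * D)ᵀ.mulVec y‖ ≤ θmax)
    (K : ℕ)
    (hK : ‖(W * D)ᵀ.mulVec e‖ ≤ θmax / γ ^ K * (1 - 2 * γ * εd - 2 * γ * μ * (s : ℝ))) :
    Function.support (adaIter D W y (fun k => θmax / γ ^ k) K) ⊆ Function.support xstar ∧
      ‖adaIter D W y (fun k => θmax / γ ^ k) K - xstar‖ ≤ 2 * θmax / γ ^ K := by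
  set S := Finset.univ.filter fun i => xstar i ≠ 0 with hS
  set G := Dᵀ * Wᵀ * D with hG
  set b := (W * D)ᵀ.mulVec e with hb
  set t := εd + μ * (s : ℝ) with ht
  have hγ0 : 0 < γ := by linarith
  have ht0 : 0 ≤ t := by positivity
  have ht1 : 2 * γ * t < 1 := by rw [ht]; linarith
  have hθ0 : 0 ≤ θmax := (norm_nonneg _).trans hθmax
  have hxS : ∀ i, i ∉ S → xstar i = 0 := fun i hi => by simpa [hS] using hi
  have hcoef : 1 - 2 * γ * εd - 2 * γ * μ * (s : ℝ) = 1 - 2 * γ * t := by rw [ht]; ring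
  have hnear {z : Fin m → ℝ} {M : ℝ} (hz : ∀ i, i ∉ S → z i = 0) (hM : ∀ i, |z i| ≤ M)
      (i : Fin m) : |G.mulVec z i - z i| ≤ t * M := by
    rw [ht, hs]
    exact abs_mulVec_sub_le hμ0 hdiag hμ hz hM i
  have hnoise (k : ℕ) (hk : k ≤ K) (i : Fin m) : |b i| ≤ θmax / γ ^ k * (1 - 2 * γ * t) := by
    have h : |b i| ≤ ‖b‖ := norm_le_pi_norm b i
    rw [hcoef] at hK
    refine h.trans (hK.trans ?_)
    gcongr
    linarith
  have hresid (x : Fin m → ℝ) :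
      (Dᵀ * Wᵀ).mulVec (y - D.mulVec x) = G.mulVec (xstar - x) + b := by
    rw [hy, hG, hb, Matrix.transpose_mul, ← Matrix.mulVec_mulVec _ (Dᵀ * Wᵀ) D, ← Matrix.mulVec_add,
      Matrix.mulVec_sub D]
    congr 1
    abel
  have hxbound : ‖xstar‖ ≤ 2 * θmax := by
    have hM (i : Fin m) : |xstar i| ≤ ‖xstar‖ := norm_le_pi_norm xstar i
    have h : ‖xstar‖ ≤ t * ‖xstar‖ + θmax + θmax * (1 - 2 * γ * t) := by
      refine (pi_norm_le_iff_of_nonneg ?_).mpr fun i => ?_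
      · have : 0 ≤ 1 - 2 * γ * t := by linarith
        positivity
      have h1 := abs_le.mp (hnear hxS hM i)
      have h2 := abs_le.mp (hnoise 0 (Nat.zero_le _) i)
      have h3 := abs_le.mp ((norm_le_pi_norm _ i).trans hθmax)
      have h4 : (W * D)ᵀ.mulVec y i = G.mulVec xstar i + b i := by
        have := congrFun (hresid 0) i
        simpa [Matrix.transpose_mul] using this
      rw [h4] at h3
      rw [pow_zero, div_one] at h2
      rw [Real.norm_eq_abs, abs_le]
      constructor <;> linarith [h1.1, h1.2, h2.1, h2.2, h3.1, h3.2]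
    have htγ : t ≤ γ * t := le_mul_of_one_le_left ht0 hγ.le
    nlinarith [mul_le_mul_of_nonneg_right htγ hθ0]
  have key : ∀ k ≤ K, (∀ i, i ∉ S → adaIter D W y (fun k => θmax / γ ^ k) k i = 0) ∧
      ∀ i, |adaIter D W y (fun k => θmax / γ ^ k) k i - xstar i| ≤ 2 * (θmax / γ ^ k) := by
    intro k
    induction k with
    | zero =>
      refine fun _ => ⟨fun _ _ => rfl, fun i => ?_⟩
      simpa [adaIter] using (norm_le_pi_norm xstar i).trans hxbound
    | succ k ih =>
      intro hk
      obtain ⟨hsupp, herr⟩ := ih (Nat.le_of_succ_le hk)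
      rw [adaIter, hresid]
      set x := adaIter D W y (fun k => θmax / γ ^ k) k
      set θ := θmax / γ ^ (k + 1) with hθ
      have hθnn : 0 ≤ θ := by positivity
      have hstep : θmax / γ ^ k = γ * θ := by
        rw [hθ, pow_succ]
        field_simp
      have hv (i : Fin m) : |(x + (G.mulVec (xstar - x) + b)) i - xstar i| ≤ θ := by
        have h1 := abs_le.mp (hnear (z := xstar - x) (M := 2 * (θmax / γ ^ k))
          (fun i hi => by simp [hxS i hi, hsupp i hi])
          (fun i => by rw [Pi.sub_apply, abs_sub_comm]; exact herr i) i)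
        have h2 := abs_le.mp (hnoise (k + 1) hk i)
        rw [hstep] at h1
        simp only [Pi.sub_apply, Pi.add_apply] at h1 ⊢
        rw [abs_le]
        constructor <;> linarith [h1.1, h1.2, h2.1, h2.2]
      refine ⟨fun i hi => softThresh_apply_eq_zero ?_, fun i => ?_⟩
      · simpa [hxS i hi] using hv i
      · refine (abs_sub_le _ ((x + (G.mulVec (xstar - x) + b)) i) _).trans ?_
        rw [two_mul]
        exact add_le_add (abs_softThresh_sub_le hθnn _ i) (hv i)
  obtain ⟨hsupp, herr⟩ := key K le_rfl
  refine ⟨fun i hi hx => hi (hsupp i (by simp [hS, hx])), ?_⟩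
  rw [mul_div_assoc]
  exact (pi_norm_le_iff_of_nonneg (by positivity)).mpr herr
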